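/- arXiv:2403.10661 — 2 statements merged into one kernel-verified Lean document; each statement's English description precedes it below -/
import Mathlib

section
/- Let V ⊆ A^n be a smooth irreducible hypersurface (i.e., a smooth irreducible variety of dimension n−1). Then deg(TV) ≤ (deg(V))². -/
open MvPolynomial

/-- A subset of affine space is an algebraic set if it is the zero locus of an
ideal of polynomials. -/
def IsAlgebraicSet {K : Type} [Field K] {n : ℕ} (W : Set (Fin n → K)) : Prop :=
  ∃ I : Ideal (MvPolynomial (Fin n) K), W = zeroLocus K I

/-- An irreducible affine variety: an algebraic set whose vanishing ideal is prime. -/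
def IsIrreducibleVariety {K : Type} [Field K] {n : ℕ} (W : Set (Fin n → K)) : Prop :=
  IsAlgebraicSet W ∧ (vanishingIdeal K W).IsPrime

/-- The dimension of an affine algebraic set: the Krull dimension of its coordinate ring. -/
noncomputable def varDim {K : Type} [Field K] {n : ℕ} (W : Set (Fin n → K)) : ℕ :=
  ENat.toNat ((ringKrullDim (MvPolynomial (Fin n) K ⧸ vanishingIdeal K W)).unbotD 0)

/-- The (Zariski) tangent space of `W` at `p`:
all `y` with `∇f(p)·y = 0` for every `f ∈ I(W)`. -/
def tangentSpaceAt {K : Type} [Field K] {n : ℕ} (W : Set (Fin n → K)) (p : Fin n → K) :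
    Set (Fin n → K) :=
  {y | ∀ f ∈ vanishingIdeal K W, ∑ i, eval p (pderiv i f) * y i = 0}

/-- The dimension of the tangent space at a point. -/
noncomputable def tangentDimAt {K : Type} [Field K] {n : ℕ} (W : Set (Fin n → K))
    (p : Fin n → K) : ℕ :=
  Module.finrank K (Submodule.span K (tangentSpaceAt W p))

/-- A point of an (irreducible) variety is a smooth point when the tangent space has
the dimension of the variety. -/
def IsSmoothAt {K : Type} [Field K] {n : ℕ} (W : Set (Fin n → K)) (p : Fin n → K) : Prop :=
  tangentDimAt W p = varDim W

/-- A variety is smooth if it is smooth at each of its points. -/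
def IsSmoothVariety {K : Type} [Field K] {n : ℕ} (W : Set (Fin n → K)) : Prop :=
  ∀ p ∈ W, IsSmoothAt W p

/-- Projection `A^{2n} → A^n` to the first `n` coordinates. -/
def fstProj {K : Type} {n : ℕ} (z : Fin (n + n) → K) : Fin n → K :=
  fun i => z (Fin.castAdd n i)

/-- Projection `A^{2n} → A^n` to the last `n` coordinates. -/
def sndProj {K : Type} {n : ℕ} (z : Fin (n + n) → K) : Fin n → K :=
  fun i => z (Fin.natAdd n i)

/-- The tangent bundle `TW ⊆ A^{2n}`: pairs `(x, y)` with `x ∈ W` and `y ∈ T_x W`. -/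
def tangentBundle {K : Type} [Field K] {n : ℕ} (W : Set (Fin n → K)) :
    Set (Fin (n + n) → K) :=
  {z | fstProj z ∈ W ∧ sndProj z ∈ tangentSpaceAt W (fstProj z)}

/-- Zariski closure of a subset of affine space. -/
def zclosure {K : Type} [Field K] {n : ℕ} (W : Set (Fin n → K)) : Set (Fin n → K) :=
  zeroLocus K (vanishingIdeal K W)

/-- The tangential variety `Tan(W)`: the Zariski closure of `π₂(TW)`. -/
def tangentialVariety {K : Type} [Field K] {n : ℕ} (W : Set (Fin n → K)) :
    Set (Fin n → K) :=
  zclosure (sndProj '' tangentBundle W)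

/-- The geometric degree of an (irreducible) affine algebraic set: the maximal finite
number of points in an intersection with an affine-linear subspace of complementary
dimension. -/
noncomputable def geomDegree {K : Type} [Field K] {n : ℕ} (W : Set (Fin n → K)) : ℕ :=
  sSup {m | ∃ L : AffineSubspace K (Fin n → K),
    Module.finrank K L.direction = n - varDim W ∧
    (W ∩ (L : Set (Fin n → K))).Finite ∧ (W ∩ (L : Set (Fin n → K))).ncard = m}

/-- A linear variety: an affine-linear subspace of affine space. -/
def IsLinearVariety {K : Type} [Field K] {n : ℕ} (W : Set (Fin n → K)) : Prop :=
  ∃ L : AffineSubspace K (Fin n → K), W = (L : Set (Fin n → K))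

/-- A line: an affine-linear subspace of dimension 1. -/
def IsLine {K : Type} [Field K] {n : ℕ} (W : Set (Fin n → K)) : Prop :=
  ∃ L : AffineSubspace K (Fin n → K), W = (L : Set (Fin n → K)) ∧
    Module.finrank K L.direction = 1

open Classical in
/-- `ω(C)`: the number of points in the fiber of `π₂ : TC → Tan(C)` over a generic
point of `Tan(C)`; it is `0` when `C` is a line. -/
noncomputable def omegaCurve {K : Type} [Field K] {n : ℕ} (C : Set (Fin n → K)) : ℕ :=
  if IsLine C then 0
  else sInf {m | ∃ Z : Set (Fin n → K), IsAlgebraicSet Z ∧ ¬ tangentialVariety C ⊆ Z ∧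
    ∀ v ∈ tangentialVariety C \ Z,
      {z ∈ tangentBundle C | sndProj z = v}.ncard = m}

/-- A smooth irreducible algebraic curve. -/
def IsSmoothCurve {K : Type} [Field K] {n : ℕ} (C : Set (Fin n → K)) : Prop :=
  IsIrreducibleVariety C ∧ varDim C = 1 ∧ IsSmoothVariety C
open MvPolynomial

/-- translation automorphism of the polynomial ring -/
noncomputable def translEquiv {K : Type} [Field K] {k : ℕ} (a : Fin k → K) :
    MvPolynomial (Fin k) K ≃ₐ[K] MvPolynomial (Fin k) K :=
  AlgEquiv.ofAlgHom (aeval fun i => X i + C (a i)) (aeval fun i => X i - C (a i))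
    (by ext i; simp [algHom_C]) (by ext i; simp [algHom_C])

theorem eval_translEquiv {K : Type} [Field K] {k : ℕ} (a p : Fin k → K)
    (f : MvPolynomial (Fin k) K) : eval p (translEquiv a f) = eval (p + a) f := by
  have : (aeval p : MvPolynomial (Fin k) K →ₐ[K] K).comp (translEquiv a).toAlgHom
      = aeval (p + a) := by
    ext i; simp [translEquiv]
  have := DFunLike.congr_fun this f
  simpa [aeval_eq_eval] using this

theorem height_point {K : Type} [Field K] [IsAlgClosed K] {k : ℕ} (p : Fin k → K) (c : ℕ)
    (h : (vanishingIdeal K ({p} : Set (Fin k → K))).height ≤ c) : k ≤ c := by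
  have : ringKrullDim (MvPolynomial (Fin k) K) ≤ c := by
    rw [show ((c : ℕ) : WithBot ℕ∞) = ((c : ℕ∞) : WithBot ℕ∞) from rfl,
      ringKrullDim_le_iff_isMaximal_height_le]
    intro m hm
    obtain ⟨q, rfl⟩ := isMaximal_iff_eq_vanishingIdeal_singleton.1 hm
    have h2 : vanishingIdeal K ({q} : Set (Fin k → K)) =
        (vanishingIdeal K ({p} : Set (Fin k → K))).comap (translEquiv (q - p)).toRingEquiv := by
      ext f
      simp [eval_translEquiv, aeval_eq_eval]
    rw [h2, RingEquiv.height_comap]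
    exact_mod_cast h
  rw [MvPolynomial.ringKrullDim_of_isNoetherianRing, ringKrullDim_eq_zero_of_field] at this
  simp at this
  exact_mod_cast this

theorem zeros_infinite {K : Type} [Field K] [IsAlgClosed K] {k : ℕ}
    (s : Finset (MvPolynomial (Fin k) K)) (hs : s.card < k) (p : Fin k → K)
    (hp : ∀ f ∈ s, eval p f = 0) :
    {q : Fin k → K | ∀ f ∈ s, eval q f = 0}.Infinite := by
  intro hfin
  have hZ : ∀ q : Fin k → K, q ∈ zeroLocus K (Ideal.span (s : Set (MvPolynomial (Fin k) K))) ↔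
      ∀ f ∈ s, eval q f = 0 := by
    intro q
    rw [zeroLocus_span]
    simp [aeval_eq_eval]
  have hmin : vanishingIdeal K ({p} : Set (Fin k → K)) ∈
      (Ideal.span (s : Set (MvPolynomial (Fin k) K))).minimalPrimes := by
    refine ⟨⟨inferInstance, ?_⟩, ?_⟩
    · rw [← le_zeroLocus_iff_le_vanishingIdeal]
      intro x hx
      rw [Set.mem_singleton_iff.1 hx]
      exact (hZ p).2 hp
    · rintro Q ⟨hQ, hIQ⟩ hQp
      have hf : (zeroLocus K Q).Finite := by
        refine hfin.subset fun q hq => ?_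
        exact (hZ q).1 (zeroLocus_anti_mono hIQ hq)
      have h1 : (hf.toFinset.inf fun q => vanishingIdeal K ({q} : Set (Fin k → K))) ≤ Q := by
        conv_rhs => rw [← IsPrime.vanishingIdeal_zeroLocus (K := K) Q]
        intro f hf'
        rw [mem_vanishingIdeal_iff]
        intro x hx
        have : f ∈ vanishingIdeal K ({x} : Set (Fin k → K)) :=
          (Finset.inf_le (f := fun q => vanishingIdeal K ({q} : Set (Fin k → K)))
            (hf.mem_toFinset.2 hx)) hf'
        simpa using this
      obtain ⟨q, -, hq⟩ := (Ideal.IsPrime.inf_le' hQ).1 h1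
      have hmax : (vanishingIdeal K ({q} : Set (Fin k → K))).IsMaximal :=
        isMaximal_iff_eq_vanishingIdeal_singleton.2 ⟨q, rfl⟩
      have := hmax.eq_of_le (J := vanishingIdeal K ({p} : Set (Fin k → K)))
        (isMaximal_iff_eq_vanishingIdeal_singleton.2 ⟨p, rfl⟩).ne_top (hq.trans hQp)
      rw [← this]; exact hq
  have := height_point p _ (Ideal.height_le_card_of_mem_minimalPrimes_span_finset hmin)
  omega

theorem exists_zero_of_not_isUnit {K : Type} [Field K] [IsAlgClosed K] {k : ℕ}
    (f : MvPolynomial (Fin k) K) (hf : ¬ IsUnit f) : ∃ p, eval p f = 0 := by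
  obtain ⟨m, hm, hfm⟩ := exists_max_ideal_of_mem_nonunits hf
  obtain ⟨q, rfl⟩ := isMaximal_iff_eq_vanishingIdeal_singleton.1 hm
  exact ⟨q, by simpa [aeval_eq_eval] using hfm⟩

theorem card_simplex (m : ℕ) :
    2 * Nat.card {n : Fin 2 →₀ ℕ | (n.sum fun _ e => e) ≤ m} = (m + 1) * (m + 2) := by
  have e : {n : Fin 2 →₀ ℕ | (n.sum fun _ e => e) ≤ m} ≃
      (Σ i : Fin (m + 1), Fin (i.1 + 1)) :=
    { toFun := fun x => ⟨⟨x.1 0 + x.1 1, by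
        have := x.2; simp [Finsupp.sum_fintype] at this; omega⟩, ⟨x.1 0, by simp⟩⟩
      invFun := fun y => ⟨Finsupp.equivFunOnFinite.symm ![y.2.1, y.1.1 - y.2.1], by
        have := y.1.2; have := y.2.2
        simp [Finsupp.sum_fintype]; omega⟩
      left_inv := fun x => by
        ext i; fin_cases i <;> simp
      right_inv := fun y => by
        obtain ⟨⟨a, ha⟩, ⟨b, hb⟩⟩ := y
        have : b + (a - b) = a := by simp at hb; omega
        simp [this]
        congr 1
        · simp [this]
        · congr! 1 }
  rw [Nat.card_congr e]
  simp only [Nat.card_eq_fintype_card, Fintype.card_sigma, Fintype.card_fin]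
  rw [Fin.sum_univ_eq_sum_range (fun i => i + 1)]
  clear e
  induction m with
  | zero => simp
  | succ m ih => rw [Finset.sum_range_succ, mul_add, ih]; ring

theorem finrank_D {K : Type} [Field K] (m : ℕ) :
    2 * Module.finrank K (restrictTotalDegree (Fin 2) K m) = (m + 1) * (m + 2) := by
  rw [← card_simplex]
  congr 1
  exact Module.finrank_eq_nat_card_basis (basisRestrictSupport K _)

theorem finite_D {K : Type} [Field K] (m : ℕ) :
    FiniteDimensional K (restrictTotalDegree (Fin 2) K m) := by
  apply FiniteDimensional.of_finrank_pos
  have := finrank_D (K := K) m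
  have : 0 < (m + 1) * (m + 2) := by positivity
  omega

open Classical in
theorem exists_lagrange {K : Type} [Field K] {k : ℕ} (S : Finset (Fin k → K)) (p : Fin k → K) :
    ∃ f : MvPolynomial (Fin k) K, ∀ q ∈ S, eval q f = if q = p then 1 else 0 := by
  have h : ∀ q : Fin k → K, q ≠ p → ∃ g : MvPolynomial (Fin k) K, eval p g = 1 ∧ eval q g = 0 := by
    intro q hq
    obtain ⟨i, hi⟩ := Function.ne_iff.1 hq
    have : p i - q i ≠ 0 := sub_ne_zero.2 hi.symm
    refine ⟨C (p i - q i)⁻¹ * (X i - C (q i)), ?_, ?_⟩ <;> simp [this]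
  choose! g hg using h
  refine ⟨∏ q ∈ S.erase p, g q, fun q hq => ?_⟩
  rw [eval_prod]
  split_ifs with hqp
  · subst hqp
    exact Finset.prod_eq_one fun r hr => (hg r (Finset.ne_of_mem_erase hr)).1
  · exact Finset.prod_eq_zero (Finset.mem_erase.2 ⟨hqp, hq⟩) (hg q hqp).2

theorem bezout_plane {K : Type} [Field K] (F G : MvPolynomial (Fin 2) K) (hF : F ≠ 0) (hG : G ≠ 0)
    (hFG : IsRelPrime F G) (S : Finset (Fin 2 → K)) (hSF : ∀ p ∈ S, eval p F = 0)
    (hSG : ∀ p ∈ S, eval p G = 0) : S.card ≤ F.totalDegree * G.totalDegree := by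
  classical
  set d := F.totalDegree with hd
  set e := G.totalDegree with he
  choose L hL using fun p => exists_lagrange S p
  set c := S.sup fun p => (L p).totalDegree with hc
  let D := fun m => restrictTotalDegree (Fin 2) K m
  have hfD : ∀ m, FiniteDimensional K (D m) := fun m => finite_D m
  have hrD : ∀ m, 2 * Module.finrank K (D m) = (m + 1) * (m + 2) := fun m => finrank_D m
  let A := (D (e + c)).map (LinearMap.mulLeft K F)
  let B := (D (d + c)).map (LinearMap.mulLeft K G)
  have hinj : ∀ H : MvPolynomial (Fin 2) K, H ≠ 0 → Function.Injective (LinearMap.mulLeft K H) := by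
    intro H hH a b hab
    exact mul_left_cancel₀ hH hab
  have hA : Module.finrank K A = Module.finrank K (D (e + c)) :=
    (LinearEquiv.finrank_eq (Submodule.equivMapOfInjective _ (hinj F hF) _)).symm
  have hB : Module.finrank K B = Module.finrank K (D (d + c)) :=
    (LinearEquiv.finrank_eq (Submodule.equivMapOfInjective _ (hinj G hG) _)).symm
  have hAB : Module.finrank K ↥(A ⊓ B) ≤ Module.finrank K (D c) := by
    have hle : A ⊓ B ≤ (D c).map (LinearMap.mulLeft K (F * G)) := by
      rintro x ⟨⟨a, ha, rfl⟩, ⟨b, hb, hab⟩⟩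
      simp only [LinearMap.mulLeft_apply] at hab ⊢
      have hdvd : G ∣ a := by
        apply hFG.symm.dvd_of_dvd_mul_left
        rw [← hab]; exact dvd_mul_right _ _
      obtain ⟨t, rfl⟩ := hdvd
      refine ⟨t, ?_, by simp⟩
      by_cases ht : t = 0
      · subst ht; exact Submodule.zero_mem _
      have h1 := (mem_restrictTotalDegree _ _ _).1 ha
      rw [totalDegree_mul_of_isDomain hG ht] at h1
      exact (mem_restrictTotalDegree _ _ _).2 (by omega)
    refine (Submodule.finrank_mono hle).trans ?_
    exact Submodule.finrank_map_le _ _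
  have hsum := Submodule.finrank_sup_add_finrank_inf_eq A B
  let ev : MvPolynomial (Fin 2) K →ₗ[K] (S → K) :=
    LinearMap.pi fun p => (aeval p.1 : MvPolynomial (Fin 2) K →ₐ[K] K).toLinearMap
  have hev : ∀ f p, ev f p = eval p.1 f := fun f p => by simp [ev, aeval_eq_eval]
  let evD := ev.comp (D (d + e + c)).subtype
  have hsurj : Function.Surjective evD := by
    intro y
    refine ⟨⟨∑ p : S, y p • L p, ?_⟩, ?_⟩
    · refine Submodule.sum_mem _ fun p _ => Submodule.smul_mem _ _ ?_
      refine (mem_restrictTotalDegree _ _ _).2 ?_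
      have : (L p).totalDegree ≤ c := Finset.le_sup (f := fun p => (L p).totalDegree) p.2
      omega
    · ext q
      change ev (∑ p : S, y p • L p) q = y q
      rw [hev, map_sum]
      simp only [smul_eval]
      have : ∀ p : S, y p * eval q.1 (L p) = if q = p then y p else 0 := by
        intro p
        rw [hL p q q.2]
        by_cases h : q = p
        · simp [h]
        · have : q.1 ≠ p.1 := fun h' => h (Subtype.ext h')
          simp [h, this]
      simp [this]
  have hrn := LinearMap.finrank_range_add_finrank_ker evD
  rw [LinearMap.range_eq_top.2 hsurj, finrank_top] at hrn
  simp only [Module.finrank_fintype_fun_eq_card, Fintype.card_coe] at hrn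
  have hker : Module.finrank K ↥(A ⊔ B) ≤ Module.finrank K (LinearMap.ker evD) := by
    have hle : A ⊔ B ≤ (LinearMap.ker evD).map (D (d + e + c)).subtype := by
      refine sup_le ?_ ?_
      · rintro _ ⟨a, ha, rfl⟩
        refine ⟨⟨F * a, (mem_restrictTotalDegree _ _ _).2 ?_⟩, ?_, rfl⟩
        · have h1 := (mem_restrictTotalDegree _ _ _).1 ha
          have := totalDegree_mul F a
          omega
        · rw [SetLike.mem_coe, LinearMap.mem_ker]
          ext p
          change ev _ p = 0
          rw [hev]; simp [hSF p.1 p.2]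
      · rintro _ ⟨a, ha, rfl⟩
        refine ⟨⟨G * a, (mem_restrictTotalDegree _ _ _).2 ?_⟩, ?_, rfl⟩
        · have h1 := (mem_restrictTotalDegree _ _ _).1 ha
          have := totalDegree_mul G a
          omega
        · rw [SetLike.mem_coe, LinearMap.mem_ker]
          ext p
          change ev _ p = 0
          rw [hev]; simp [hSG p.1 p.2]
    refine (Submodule.finrank_mono hle).trans ?_
    exact Submodule.finrank_map_le _ _
  have e1 := hrD (e + c)
  have e2 := hrD (d + c)
  have e3 := hrD c
  have e4 := hrD (d + e + c)
  have key : 2 * S.card + (e + c + 1) * (e + c + 2) + (d + c + 1) * (d + c + 2) ≤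
    (d + e + c + 1) * (d + e + c + 2) + (c + 1) * (c + 2) := by omega
  nlinarith [key]

noncomputable def linePoly {K : Type} [Field K] {n : ℕ} (p v : Fin n → K)
    (f : MvPolynomial (Fin n) K) : Polynomial K :=
  aeval (fun i => Polynomial.C (p i) + Polynomial.C (v i) * Polynomial.X) f

theorem eval_linePoly {K : Type} [Field K] {n : ℕ} (p v : Fin n → K)
    (f : MvPolynomial (Fin n) K) (t : K) :
    (linePoly p v f).eval t = eval (p + t • v) f := by
  have : (Polynomial.aeval t).comp
      (aeval (fun i => Polynomial.C (p i) + Polynomial.C (v i) * Polynomial.X)) =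
      (aeval (p + t • v) : MvPolynomial (Fin n) K →ₐ[K] K) := by
    ext i; simp; ring
  have := DFunLike.congr_fun this f
  simpa [linePoly, aeval_eq_eval, Polynomial.coe_aeval_eq_eval] using this

theorem prod_line {K : Type} [Field K] {n : ℕ} (p v : Fin n → K) (s : Fin n → ℕ)
    (T : Finset (Fin n)) :
    (∏ i ∈ T, (Polynomial.C (p i) + Polynomial.C (v i) * Polynomial.X) ^ s i).natDegree
      ≤ ∑ i ∈ T, s i ∧
    (∏ i ∈ T, (Polynomial.C (p i) + Polynomial.C (v i) * Polynomial.X) ^ s i).coeff (∑ i ∈ T, s i)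
      = ∏ i ∈ T, v i ^ s i := by
  classical
  induction T using Finset.induction_on with
  | empty => simp
  | insert a T ha ih =>
    rw [Finset.prod_insert ha, Finset.sum_insert ha, Finset.prod_insert ha]
    have h1 : (Polynomial.C (p a) + Polynomial.C (v a) * Polynomial.X).natDegree ≤ 1 := by
      compute_degree
    have h2 : ((Polynomial.C (p a) + Polynomial.C (v a) * Polynomial.X) ^ s a).natDegree ≤ s a :=
      (Polynomial.natDegree_pow_le_of_le _ h1).trans (by simp)
    refine ⟨Polynomial.natDegree_mul_le_of_le h2 ih.1, ?_⟩
    rw [Polynomial.coeff_mul_add_eq_of_natDegree_le h2 ih.1, ih.2]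
    congr 1
    have := Polynomial.coeff_pow_of_natDegree_le (m := s a) h1
    simpa using this

theorem linePoly_eq {K : Type} [Field K] {n : ℕ} (p v : Fin n → K)
    (f : MvPolynomial (Fin n) K) : linePoly p v f = ∑ s ∈ f.support, Polynomial.C (f.coeff s) *
      ∏ i, (Polynomial.C (p i) + Polynomial.C (v i) * Polynomial.X) ^ s i := by
  rw [linePoly, aeval_def, eval₂_eq']
  rfl

theorem natDegree_linePoly {K : Type} [Field K] {n : ℕ} (p v : Fin n → K)
    (f : MvPolynomial (Fin n) K) : (linePoly p v f).natDegree ≤ f.totalDegree := by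
  rw [linePoly_eq]
  refine Polynomial.natDegree_sum_le_of_forall_le _ _ fun s hs => ?_
  refine (Polynomial.natDegree_C_mul_le _ _).trans ((prod_line p v s _).1.trans ?_)
  have := le_totalDegree hs
  rwa [Finsupp.sum_fintype _ _ (by simp)] at this

theorem coeff_linePoly {K : Type} [Field K] {n : ℕ} (p v : Fin n → K)
    (f : MvPolynomial (Fin n) K) : (linePoly p v f).coeff f.totalDegree =
      eval v (homogeneousComponent f.totalDegree f) := by
  rw [linePoly_eq, homogeneousComponent_apply, Polynomial.finsetSum_coeff, map_sum,
    Finset.sum_filter]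
  refine Finset.sum_congr rfl fun s hs => ?_
  have h := prod_line p v s Finset.univ
  have hle := le_totalDegree hs
  rw [Finsupp.sum_fintype _ _ (by simp)] at hle
  rw [Polynomial.coeff_C_mul]
  have hdeg : s.degree = ∑ i, s i := Finsupp.degree_eq_sum s
  split_ifs with h1
  · rw [← h1, hdeg, h.2, eval_monomial, Finsupp.prod_fintype _ _ (by simp)]
  · rw [Polynomial.coeff_eq_zero_of_natDegree_lt, mul_zero]
    rw [hdeg] at h1
    exact h.1.trans_lt (lt_of_le_of_ne hle h1)

noncomputable def shearEquiv {K : Type} [Field K] {m : ℕ} (v : Fin (m + 1) → K) (hv : v 0 ≠ 0) :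
    MvPolynomial (Fin (m + 1)) K ≃ₐ[K] MvPolynomial (Fin (m + 1)) K :=
  have hh : (C (v 0)⁻¹ * C (v 0) : MvPolynomial (Fin (m + 1)) K) = 1 := by
    rw [← C_mul, inv_mul_cancel₀ hv, C_1]
  have hh' : (C (v 0) * C (v 0)⁻¹ : MvPolynomial (Fin (m + 1)) K) = 1 := by
    rw [mul_comm, hh]
  AlgEquiv.ofAlgHom
    (aeval (Fin.cons (C (v 0) * X 0) fun i => X i.succ + C (v i.succ) * X 0 :
      Fin (m + 1) → MvPolynomial (Fin (m + 1)) K))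
    (aeval (Fin.cons (C (v 0)⁻¹ * X 0) fun i => X i.succ - C (v i.succ * (v 0)⁻¹) * X 0 :
      Fin (m + 1) → MvPolynomial (Fin (m + 1)) K))
    (by
      ext i : 1
      refine Fin.cases ?_ (fun i => ?_) i
      · rw [AlgHom.comp_apply]; simp [algHom_C, hh, hh', ← mul_assoc]
      · simp [algHom_C, mul_assoc]
        rw [← mul_assoc (C (v 0)⁻¹), hh]; ring)
    (by
      ext i : 1
      refine Fin.cases ?_ (fun i => ?_) i
      · rw [AlgHom.comp_apply]; simp [algHom_C, hh, hh', ← mul_assoc]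
      · simp [algHom_C, mul_assoc])

theorem eval_shearEquiv {K : Type} [Field K] {m : ℕ} (v : Fin (m + 1) → K) (hv : v 0 ≠ 0)
    (x : Fin m → K) (t : K) (f : MvPolynomial (Fin (m + 1)) K) :
    eval (Fin.cons t x : Fin (m + 1) → K) (shearEquiv v hv f) =
      eval ((Fin.cons 0 x : Fin (m + 1) → K) + t • v) f := by
  have : (aeval (Fin.cons t x : Fin (m + 1) → K) : MvPolynomial (Fin (m + 1)) K →ₐ[K] K).comp
      (shearEquiv v hv).toAlgHom = aeval ((Fin.cons 0 x : Fin (m + 1) → K) + t • v) := by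
    ext i : 1
    refine Fin.cases ?_ (fun i => ?_) i
    · simp [shearEquiv, mul_comm]
    · simp [shearEquiv, mul_comm]
  have := DFunLike.congr_fun this f
  simpa [aeval_eq_eval] using this

theorem exists_combo {A : Type} [CommRing A] [IsDomain A] [UniqueFactorizationMonoid A] [CharZero A]
    (F : Polynomial A) (hF : Irreducible F) (hd : F.natDegree ≠ 0) :
    ∃ a b : Polynomial A, ∃ r : A, r ≠ 0 ∧
      a * F + b * Polynomial.derivative F = Polynomial.C r := by
  let := Classical.choice (inferInstance : Nonempty (NormalizedGCDMonoid A))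
  let L := FractionRing A
  have hp := hF.isPrimitive hd
  have hirr : Irreducible (F.map (algebraMap A L)) :=
    (hp.irreducible_iff_irreducible_map_fraction_map).1 hF
  have : CharZero L := charZero_of_injective_algebraMap (IsFractionRing.injective A L)
  obtain ⟨a, b, hab⟩ := hirr.separable
  obtain ⟨r, hr, h1⟩ := IsLocalization.integerNormalization_spec (nonZeroDivisors A) a
  obtain ⟨s, hs, h2⟩ := IsLocalization.integerNormalization_spec (nonZeroDivisors A) b
  refine ⟨Polynomial.C s * IsLocalization.integerNormalization (nonZeroDivisors A) a,
    Polynomial.C r * IsLocalization.integerNormalization (nonZeroDivisors A) b, s * r,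
    mul_ne_zero (nonZeroDivisors.ne_zero hs) (nonZeroDivisors.ne_zero hr), ?_⟩
  apply Polynomial.map_injective _ (IsFractionRing.injective A L)
  have h1' := h1.trans (algebraMap_smul L r a).symm
  have h2' := h2.trans (algebraMap_smul L s b).symm
  rw [Polynomial.derivative_map] at hab
  simp only [Polynomial.map_add, Polynomial.map_mul, Polynomial.map_C, h1', h2',
    Polynomial.smul_eq_C_mul, map_mul]
  linear_combination (Polynomial.C (algebraMap A L s) * Polynomial.C (algebraMap A L r)) * hab

theorem exists_generic_line {K : Type} [Field K] [IsAlgClosed K] [CharZero K] {m : ℕ}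
    (f : MvPolynomial (Fin (m + 1)) K) (hf : Irreducible f) (hd : f.totalDegree ≠ 0) :
    ∃ p v : Fin (m + 1) → K, v ≠ 0 ∧
      {t : K | eval (p + t • v) f = 0}.ncard = f.totalDegree ∧
      {t : K | eval (p + t • v) f = 0}.Finite := by
  classical
  have hfd : homogeneousComponent f.totalDegree f ≠ 0 := by
    obtain ⟨s, hs, hs'⟩ := Finset.exists_mem_eq_sup f.support
      (Finset.nonempty_iff_ne_empty.2 (support_eq_empty.not.2 hf.ne_zero)) (fun s => s.sum fun _ e => e)
    intro h0
    have h1 := congrArg (coeff s) h0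
    rw [coeff_homogeneousComponent, if_pos, coeff_zero] at h1
    · exact (mem_support_iff.1 hs) h1
    · rw [totalDegree, hs']; rfl
  have hne : homogeneousComponent f.totalDegree f * X 0 ≠ 0 := mul_ne_zero hfd (X_ne_zero 0)
  obtain ⟨v, hv⟩ : ∃ v, eval v (homogeneousComponent f.totalDegree f * X 0) ≠ 0 := by
    by_contra! h
    exact hne (MvPolynomial.funext (by simpa using h))
  rw [map_mul, eval_X] at hv
  have hv0 := right_ne_zero_of_mul hv
  have hv1 := left_ne_zero_of_mul hv
  set F := finSuccEquiv K m (shearEquiv v hv0 f) with hFdef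
  have hF : Irreducible F := by
    rw [hFdef, MulEquiv.irreducible_iff, MulEquiv.irreducible_iff]; exact hf
  have hFe : ∀ x : Fin m → K, F.map (eval x) = linePoly (Fin.cons 0 x) v f := by
    intro x
    apply Polynomial.funext
    intro t
    rw [hFdef, ← eval_eq_eval_mv_eval', eval_shearEquiv, eval_linePoly]
  have hdeg : ∀ x : Fin m → K, (F.map (eval x)).natDegree = f.totalDegree := by
    intro x
    rw [hFe]
    refine le_antisymm (natDegree_linePoly _ _ _) (Polynomial.le_natDegree_of_ne_zero ?_)
    rwa [coeff_linePoly]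
  have hFd : F.natDegree ≠ 0 := by
    intro h
    have := Polynomial.natDegree_map_le (p := F) (f := eval (0 : Fin m → K))
    rw [hdeg] at this
    omega
  obtain ⟨a, b, r, hr, hab⟩ := exists_combo F hF hFd
  obtain ⟨x, hx⟩ : ∃ x, eval x r ≠ 0 := by
    by_contra! h
    exact hr (MvPolynomial.funext (by simpa using h))
  have hsep : (F.map (eval x)).Separable := by
    have h1 := congrArg (Polynomial.map (eval x)) hab
    simp only [Polynomial.map_add, Polynomial.map_mul, Polynomial.map_C,
      ← Polynomial.derivative_map] at h1
    refine ⟨Polynomial.C (eval x r)⁻¹ * a.map (eval x), Polynomial.C (eval x r)⁻¹ * b.map (eval x), ?_⟩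
    rw [mul_assoc, mul_assoc, ← mul_add, h1, ← Polynomial.C_mul, inv_mul_cancel₀ hx,
      Polynomial.C_1]
  have hcard := Polynomial.card_rootSet_eq_natDegree (K := K) hsep (IsAlgClosed.splits_domain _)
  have hset : {t : K | eval ((Fin.cons 0 x : Fin (m + 1) → K) + t • v) f = 0} =
      (F.map (eval x)).rootSet K := by
    ext t
    have h0 : F.map (eval x) ≠ 0 := hsep.ne_zero
    rw [Polynomial.mem_rootSet]
    simp only [h0, ne_eq, not_false_eq_true, true_and, Set.mem_ofPred_eq]
    rw [Polynomial.coe_aeval_eq_eval, hFe, eval_linePoly]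
  refine ⟨Fin.cons 0 x, v, fun h => hv0 (by simp [h]), ?_, ?_⟩
  · rw [hset, ← hdeg x, ← hcard, ← Nat.card_coe_set_eq, Nat.card_eq_fintype_card]
  · rw [hset]; exact Polynomial.rootSet_finite _ _

theorem exists_principal {K : Type} [Field K] {m : ℕ} (P : Ideal (MvPolynomial (Fin (m + 1)) K))
    (hP : P.IsPrime)
    (h : ENat.toNat ((ringKrullDim (MvPolynomial (Fin (m + 1)) K ⧸ P)).unbotD 0) = m) :
    ∃ f, Irreducible f ∧ P = Ideal.span {f} := by
  have hR : ringKrullDim (MvPolynomial (Fin (m + 1)) K) = ((m + 1 : ℕ) : WithBot ℕ∞) := by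
    rw [MvPolynomial.ringKrullDim_of_isNoetherianRing, ringKrullDim_eq_zero_of_field]; simp
  have hle : ringKrullDim (MvPolynomial (Fin (m + 1)) K ⧸ P) ≤ ((m + 1 : ℕ) : WithBot ℕ∞) := by
    rw [← hR]; exact ringKrullDim_quotient_le P
  have : Nontrivial (MvPolynomial (Fin (m + 1)) K ⧸ P) := Ideal.Quotient.nontrivial_iff.2 hP.ne_top
  have hdim : ringKrullDim (MvPolynomial (Fin (m + 1)) K ⧸ P) = ((m : ℕ) : WithBot ℕ∞) := by
    have h0 := ringKrullDim_nonneg_of_nontrivial (R := MvPolynomial (Fin (m + 1)) K ⧸ P)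
    generalize ringKrullDim (MvPolynomial (Fin (m + 1)) K ⧸ P) = D at *
    induction D with
    | bot => simp at h0
    | coe D =>
      have h2 : D ≤ ((m + 1 : ℕ) : ℕ∞) := by exact_mod_cast hle
      have h3 : D ≠ ⊤ := fun h => by simp [h] at h2
      lift D to ℕ using h3
      simp at h
      rw [h]; rfl
  have hbot : P ≠ ⊥ := by
    rintro rfl
    rw [ringKrullDim_eq_of_ringEquiv (RingEquiv.quotientBot _), hR] at hdim
    have : m + 1 = m := by exact_mod_cast hdim
    omega
  obtain ⟨f, hfP, hf⟩ := Ideal.IsPrime.exists_mem_prime_of_ne_bot hP hbot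
  refine ⟨f, hf.irreducible, ?_⟩
  by_contra hne
  have hsub : Ideal.span {f} ≤ P := (Ideal.span_singleton_le_iff_mem _).2 hfP
  obtain ⟨g, hgP, hg⟩ := SetLike.exists_of_lt (lt_of_le_of_ne hsub (Ne.symm hne))
  have hpr : (Ideal.span {f}).IsPrime := (Ideal.span_singleton_prime hf.ne_zero).2 hf
  have h1 := ringKrullDim_quotient_succ_le_of_nonZeroDivisor
    (mem_nonZeroDivisors_of_ne_zero hf.ne_zero)
  have h2 := ringKrullDim_succ_le_of_surjective (Ideal.Quotient.factor hsub)
    (Ideal.Quotient.factor_surjective hsub) (r := Ideal.Quotient.mk _ g)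
    (mem_nonZeroDivisors_of_ne_zero (by rwa [Ne, Ideal.Quotient.eq_zero_iff_mem]))
    (by rw [Ideal.Quotient.factor_mk]; exact Ideal.Quotient.eq_zero_iff_mem.2 hgP)
  have h3 : ringKrullDim (MvPolynomial (Fin (m + 1)) K ⧸ P) + 1 + 1 ≤ ((m + 1 : ℕ) : WithBot ℕ∞) := by
    rw [← hR]; exact le_trans (by gcongr) h1
  rw [hdim] at h3
  have : m + 1 + 1 ≤ m + 1 := by exact_mod_cast h3
  omega

theorem count_one' {K : Type} [Field K] [Infinite K] (F : MvPolynomial (Fin 1) K) (hF : F ≠ 0) :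
    {c : Fin 1 → K | eval c F = 0}.Finite ∧
    {c : Fin 1 → K | eval c F = 0}.ncard ≤ F.totalDegree := by
  classical
  obtain ⟨x, hx⟩ : ∃ x, eval x F ≠ 0 := by
    by_contra! h
    exact hF (MvPolynomial.funext (by simpa using h))
  have hc : ∀ c : Fin 1 → K, (0 : Fin 1 → K) + c 0 • (1 : Fin 1 → K) = c := by
    intro c; ext i; fin_cases i; simp
  have hl : linePoly 0 1 F ≠ 0 := by
    intro h
    apply hx
    rw [← hc x, ← eval_linePoly, h, Polynomial.eval_zero]
  have hsub : {c : Fin 1 → K | eval c F = 0} ⊆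
      ((linePoly 0 1 F).roots.toFinset.image (fun t => (fun _ => t : Fin 1 → K)) :
        Finset (Fin 1 → K)) := by
    intro c hcF
    rw [Finset.mem_coe, Finset.mem_image]
    refine ⟨c 0, ?_, ?_⟩
    · rw [Multiset.mem_toFinset, Polynomial.mem_roots hl, Polynomial.IsRoot, eval_linePoly, hc]
      exact hcF
    · ext i; fin_cases i; rfl
  refine ⟨(Finset.finite_toSet _).subset hsub, ?_⟩
  refine (Set.ncard_le_ncard hsub (Finset.finite_toSet _)).trans ?_
  rw [Set.ncard_coe_finset]
  exact Finset.card_image_le.trans ((Multiset.toFinset_card_le _).trans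
    ((Polynomial.card_roots' _).trans (natDegree_linePoly _ _ _)))

theorem count_one {K : Type} [Field K] [Infinite K] (F : MvPolynomial (Fin 1) K)
    (hfin : {c : Fin 1 → K | eval c F = 0}.Finite) :
    {c : Fin 1 → K | eval c F = 0}.ncard ≤ F.totalDegree := by
  refine (count_one' F ?_).2
  rintro rfl
  simp only [map_zero] at hfin
  exact Set.infinite_univ (by simpa using hfin)

theorem count_affine {K : Type} [Field K] [IsAlgClosed K] {k d : ℕ}
    (F G : MvPolynomial (Fin k) K) (hd : 1 ≤ d) (hF : F.totalDegree ≤ d) (hG : G.totalDegree ≤ d)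
    (hfin : {c : Fin k → K | eval c F = 0 ∧ eval c G = 0}.Finite) :
    {c : Fin k → K | eval c F = 0 ∧ eval c G = 0}.ncard ≤ d ^ 2 := by
  classical
  have : Infinite K := IsAlgClosed.instInfinite
  have hdd : d ≤ d ^ 2 := by nlinarith
  rcases Set.eq_empty_or_nonempty {c : Fin k → K | eval c F = 0 ∧ eval c G = 0} with he | ⟨p, hp⟩
  · rw [he]; simp
  match k, F, G, hF, hG, hfin, p, hp with
  | 0, F, G, hF, hG, hfin, p, hp =>
    have := Set.ncard_le_one_of_subsingleton {c : Fin 0 → K | eval c F = 0 ∧ eval c G = 0}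
    omega
  | 1, F, G, hF, hG, hfin, p, hp =>
    by_cases h0 : {c : Fin 1 → K | eval c F = 0}.Finite
    · have h1 := count_one F h0
      have h2 := Set.ncard_le_ncard (s := {c : Fin 1 → K | eval c F = 0 ∧ eval c G = 0})
        (t := {c : Fin 1 → K | eval c F = 0}) (fun c hc => hc.1) h0
      omega
    · have hF0 : F = 0 := by
        by_contra h
        exact h0 (count_one' F h).1
      subst hF0
      simp only [map_zero, true_and] at hfin ⊢
      have := count_one G hfin
      omega
  | 2, F, G, hF, hG, hfin, p, hp =>
    have hrel : IsRelPrime F G := by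
      intro H h1 h2
      by_contra hu
      obtain ⟨q, hq⟩ := exists_zero_of_not_isUnit H hu
      have := zeros_infinite {H} (by simp) q (by simpa using hq)
      refine this (hfin.subset fun c hc => ?_)
      have hc' : eval c H = 0 := by simpa using hc
      obtain ⟨a, rfl⟩ := h1
      obtain ⟨b, rfl⟩ := h2
      constructor <;> simp [hc']
    have hF0 : F ≠ 0 := by
      rintro rfl
      have hu := isRelPrime_zero_left.1 hrel
      have := hu.map (eval p)
      rw [hp.2] at this
      simp at this
    have hG0 : G ≠ 0 := by
      rintro rfl
      have hu := isRelPrime_zero_right.1 hrel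
      have := hu.map (eval p)
      rw [hp.1] at this
      simp at this
    have := bezout_plane F G hF0 hG0 hrel hfin.toFinset
      (fun q hq => ((hfin.mem_toFinset).1 hq).1) (fun q hq => ((hfin.mem_toFinset).1 hq).2)
    rw [Set.ncard_eq_toFinset_card _ hfin]
    nlinarith
  | k + 3, F, G, hF, hG, hfin, p, hp =>
    exfalso
    have := zeros_infinite {F, G} (lt_of_le_of_lt Finset.card_le_two (by omega)) p
      (by simpa using hp)
    exact this (by simpa using hfin)

noncomputable def pullPoly {K : Type} [Field K] {N k : ℕ} (p : Fin N → K) (b : Fin k → Fin N → K)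
    (f : MvPolynomial (Fin N) K) : MvPolynomial (Fin k) K :=
  aeval (fun j => C (p j) + ∑ i, C (b i j) * X i) f

theorem eval_pullPoly {K : Type} [Field K] {N k : ℕ} (p : Fin N → K) (b : Fin k → Fin N → K)
    (f : MvPolynomial (Fin N) K) (c : Fin k → K) :
    eval c (pullPoly p b f) = eval (p + ∑ i, c i • b i) f := by
  have : (aeval c).comp (aeval (fun j => C (p j) + ∑ i, C (b i j) * X i)) =
      (aeval (p + ∑ i, c i • b i) : MvPolynomial (Fin N) K →ₐ[K] K) := by
    ext i
    simp [Finset.sum_apply, mul_comm]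
  have := DFunLike.congr_fun this f
  simpa [pullPoly, aeval_eq_eval] using this

theorem totalDegree_pullPoly {K : Type} [Field K] {N k : ℕ} (p : Fin N → K)
    (b : Fin k → Fin N → K) (f : MvPolynomial (Fin N) K) :
    (pullPoly p b f).totalDegree ≤ f.totalDegree := by
  rw [pullPoly, aeval_def, eval₂_eq']
  refine totalDegree_finsetSum_le fun s hs => ?_
  refine (totalDegree_mul _ _).trans ?_
  rw [algebraMap_eq, totalDegree_C, zero_add]
  refine (totalDegree_finsetProd _ _).trans ?_
  have hle := le_totalDegree hs
  rw [Finsupp.sum_fintype _ _ (by simp)] at hle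
  refine le_trans (Finset.sum_le_sum fun j _ => ?_) hle
  refine (totalDegree_pow _ _).trans ?_
  have : (C (p j) + ∑ i, C (b i j) * X i : MvPolynomial (Fin k) K).totalDegree ≤ 1 := by
    refine (totalDegree_add _ _).trans (max_le (by simp) ?_)
    refine totalDegree_finsetSum_le fun i _ => ?_
    refine (totalDegree_mul _ _).trans ?_
    simp
  nlinarith

theorem exists_param {K : Type} [Field K] {N : ℕ} (L : AffineSubspace K (Fin N → K))
    (p : Fin N → K) (hp : p ∈ L) :
    ∃ b : Fin (Module.finrank K L.direction) → Fin N → K,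
      Function.Injective (fun c : Fin (Module.finrank K L.direction) → K => p + ∑ i, c i • b i) ∧
      Set.range (fun c : Fin (Module.finrank K L.direction) → K => p + ∑ i, c i • b i) =
        (L : Set (Fin N → K)) := by
  let B := Module.finBasis K L.direction
  refine ⟨fun i => (B i : Fin N → K), ?_, ?_⟩
  · intro c c' h
    have h1 : ∑ i, c i • B i = ∑ i, c' i • B i := by
      apply Subtype.ext
      have := add_left_cancel h
      simpa using this
    rw [← B.equivFun_symm_apply, ← B.equivFun_symm_apply] at h1
    exact B.equivFun.symm.injective h1
  · ext x
    constructor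
    · rintro ⟨c, rfl⟩
      have : (∑ i, c i • B i : L.direction).1 +ᵥ p ∈ L :=
        AffineSubspace.vadd_mem_of_mem_direction (Subtype.property _) hp
      simpa [add_comm] using this
    · intro hx
      have hd : x -ᵥ p ∈ L.direction := AffineSubspace.vsub_mem_direction hx hp
      refine ⟨B.equivFun ⟨x -ᵥ p, hd⟩, ?_⟩
      have := congrArg Subtype.val (B.sum_equivFun ⟨x -ᵥ p, hd⟩)
      simp only [Submodule.coe_sum, Submodule.coe_smul] at this
      change p + ∑ i, _ = x
      rw [this]
      simp

theorem pull_set {K : Type} [Field K] {N : ℕ} (L : AffineSubspace K (Fin N → K))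
    (W : Set (Fin N → K)) {k : ℕ} (p : Fin N → K) (b : Fin k → Fin N → K)
    (hi : Function.Injective (fun c : Fin k → K => p + ∑ i, c i • b i))
    (hr : Set.range (fun c : Fin k → K => p + ∑ i, c i • b i) = (L : Set (Fin N → K)))
    (T : Set (Fin k → K)) (hT : ∀ c, c ∈ T ↔ (p + ∑ i, c i • b i) ∈ W)
    (hfin : (W ∩ L).Finite) : T.Finite ∧ T.ncard = (W ∩ L).ncard := by
  have : (fun c : Fin k → K => p + ∑ i, c i • b i) '' T = W ∩ L := by
    rw [← hr, Set.inter_comm, ← Set.image_preimage_eq_range_inter]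
    congr 1
    ext c; exact hT c
  rw [← this] at hfin ⊢
  exact ⟨(Set.finite_image_iff hi.injOn).1 hfin, (Set.ncard_image_of_injective _ hi).symm⟩

theorem totalDegree_pderiv_le' {K : Type} [Field K] {n : ℕ} (f : MvPolynomial (Fin n) K)
    (i : Fin n) : (pderiv i f).totalDegree ≤ f.totalDegree - 1 := by
  conv_lhs => rw [f.as_sum, map_sum]
  refine totalDegree_finsetSum_le fun s hs => ?_
  rw [pderiv_monomial]
  by_cases h : s i = 0
  · simp [h]
  refine (totalDegree_monomial_le _ _).trans ?_
  have hle := le_totalDegree hs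
  rw [Finsupp.sum_fintype _ _ (by simp)] at hle ⊢
  have : ∑ j, (s - Finsupp.single i 1 : Fin n →₀ ℕ) j + 1 = ∑ j, s j := by
    rw [← Finset.add_sum_erase _ _ (Finset.mem_univ i),
      ← Finset.add_sum_erase _ s (Finset.mem_univ i)]
    have : ∑ j ∈ Finset.univ.erase i, (s - Finsupp.single i 1 : Fin n →₀ ℕ) j =
        ∑ j ∈ Finset.univ.erase i, s j := by
      refine Finset.sum_congr rfl fun j hj => ?_
      simp [(Finset.ne_of_mem_erase hj).symm]
    rw [this]
    simp
    omega
  change ∑ j, (s - Finsupp.single i 1 : Fin n →₀ ℕ) j ≤ _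
  omega

theorem degree_le_geomDegree {K : Type} [Field K] [IsAlgClosed K] [CharZero K]
    {m : ℕ} (V : Set (Fin (m + 1) → K)) (hd : varDim V = m)
    (f : MvPolynomial (Fin (m + 1)) K) (hf : Irreducible f) (hdeg : f.totalDegree ≠ 0)
    (hV : ∀ x, x ∈ V ↔ eval x f = 0) : f.totalDegree ≤ geomDegree V := by
  have : Infinite K := IsAlgClosed.instInfinite
  obtain ⟨p, v, hv, hcard, hfin⟩ := exists_generic_line f hf hdeg
  have hone : m + 1 - varDim V = 1 := by omega
  refine le_csSup ⟨f.totalDegree, ?_⟩ ⟨AffineSubspace.mk' p (Submodule.span K {v}), ?_, ?_⟩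
  · rintro _ ⟨L, hL, hLfin, rfl⟩
    rw [hone] at hL
    rcases Set.eq_empty_or_nonempty (V ∩ (L : Set (Fin (m + 1) → K))) with he | ⟨q, hq⟩
    · rw [he]; simp
    have hpar := exists_param L q hq.2
    rw [hL] at hpar
    obtain ⟨b, hi, hr⟩ := hpar
    obtain ⟨h1, h2⟩ := pull_set L V q b hi hr {c | eval c (pullPoly q b f) = 0}
      (fun c => by rw [hV]; simp [eval_pullPoly]) hLfin
    rw [← h2]
    exact (count_one _ h1).trans (totalDegree_pullPoly _ _ _)
  · rw [AffineSubspace.direction_mk', hone, finrank_span_singleton hv]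
  · have himg : V ∩ (AffineSubspace.mk' p (Submodule.span K {v}) : Set (Fin (m + 1) → K)) =
        (fun t : K => p + t • v) '' {t : K | eval (p + t • v) f = 0} := by
      ext x
      constructor
      · rintro ⟨hx, hxL⟩
        rw [SetLike.mem_coe, AffineSubspace.mem_mk', Submodule.mem_span_singleton] at hxL
        obtain ⟨t, ht⟩ := hxL
        have hxt : p + t • v = x := by rw [ht]; simp
        refine ⟨t, ?_, hxt⟩
        change eval (p + t • v) f = 0
        rw [hxt]; exact (hV x).1 hx
      · rintro ⟨t, ht, rfl⟩
        refine ⟨(hV _).2 ht, ?_⟩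
        rw [SetLike.mem_coe, AffineSubspace.mem_mk', Submodule.mem_span_singleton]
        exact ⟨t, by simp⟩
    have hinj : Function.Injective (fun t : K => p + t • v) := by
      intro a b hab
      exact smul_left_injective K hv (add_left_cancel hab)
    rw [himg]
    exact ⟨hfin.image _, by rw [Set.ncard_image_of_injective _ hinj, hcard]⟩

/-- The second equation `∑ ∂ᵢf(x) yᵢ` of the tangent bundle. -/
noncomputable def tangentPoly {K : Type} [Field K] {n : ℕ} (f : MvPolynomial (Fin n) K) :
    MvPolynomial (Fin (n + n)) K :=
  ∑ i, rename (Fin.castAdd n) (pderiv i f) * X (Fin.natAdd n i)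

theorem eval_rename_fst {K : Type} [Field K] {n : ℕ} (f : MvPolynomial (Fin n) K)
    (z : Fin (n + n) → K) : eval z (rename (Fin.castAdd n) f) = eval (fstProj z) f := by
  rw [eval_rename]; rfl

theorem eval_tangentPoly {K : Type} [Field K] {n : ℕ} (f : MvPolynomial (Fin n) K)
    (z : Fin (n + n) → K) : eval z (tangentPoly f) =
      ∑ i, eval (fstProj z) (pderiv i f) * sndProj z i := by
  rw [tangentPoly, map_sum]
  refine Finset.sum_congr rfl fun i _ => ?_
  rw [map_mul, eval_rename_fst, eval_X]; rfl

theorem totalDegree_tangentPoly {K : Type} [Field K] {n : ℕ} (f : MvPolynomial (Fin n) K)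
    (hdeg : f.totalDegree ≠ 0) : (tangentPoly f).totalDegree ≤ f.totalDegree := by
  refine totalDegree_finsetSum_le fun i _ => ?_
  refine (totalDegree_mul _ _).trans ?_
  have h1 := totalDegree_rename_le (Fin.castAdd n) (pderiv i f)
  have h2 := totalDegree_pderiv_le' f i
  rw [totalDegree_X]
  omega

theorem mem_tangentBundle_iff {K : Type} [Field K] {n : ℕ} (V : Set (Fin n → K))
    (f : MvPolynomial (Fin n) K) (hI : vanishingIdeal K V = Ideal.span {f})
    (hV : ∀ x, x ∈ V ↔ eval x f = 0) (z : Fin (n + n) → K) :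
    z ∈ tangentBundle V ↔
      eval z (rename (Fin.castAdd n) f) = 0 ∧ eval z (tangentPoly f) = 0 := by
  rw [eval_rename_fst, eval_tangentPoly]
  change (fstProj z ∈ V ∧ ∀ g ∈ vanishingIdeal K V, _) ↔ _
  rw [hV, hI]
  refine and_congr_right fun hz => ⟨fun h => h f (Ideal.mem_span_singleton_self f), ?_⟩
  intro h g hg
  obtain ⟨a, rfl⟩ := Ideal.mem_span_singleton'.1 hg
  have : ∀ i, eval (fstProj z) (pderiv i (a * f)) * sndProj z i =
      eval (fstProj z) a * (eval (fstProj z) (pderiv i f) * sndProj z i) := by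
    intro i
    rw [pderiv_mul, map_add, map_mul, map_mul, hz]; ring
  simp only [this]
  rw [← Finset.mul_sum, h, mul_zero]

/-- For a smooth irreducible hypersurface `V ⊆ A^n`, `deg(TV) ≤ deg(V)²`. -/
theorem degree_tangentBundle_hypersurface {K : Type} [Field K] [IsAlgClosed K] [CharZero K]
    {n : ℕ} (V : Set (Fin n → K)) (h1 : IsIrreducibleVariety V)
    (h2 : IsSmoothVariety V) (hd : varDim V = n - 1) :
    geomDegree (tangentBundle V) ≤ (geomDegree V) ^ 2 := by
  cases n with
  | zero =>
    have hne : V.Nonempty := by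
      rw [Set.nonempty_iff_ne_empty]
      rintro rfl
      exact h1.2.ne_top vanishingIdeal_empty
    have hV : 1 ≤ geomDegree V := by
      refine le_csSup ⟨1, ?_⟩ ⟨⊤, ?_, Set.toFinite _, ?_⟩
      · rintro _ ⟨L, -, -, rfl⟩
        exact Set.ncard_le_one_of_subsingleton _
      · simp
        exact Subsingleton.elim _ _
      · obtain ⟨x, hx⟩ := hne
        rw [Set.ncard_eq_one]
        refine ⟨x, ?_⟩
        ext y
        rw [Subsingleton.elim y x]
        simp [hx]
    have hT : geomDegree (tangentBundle V) ≤ 1 := by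
      refine csSup_le' ?_
      rintro _ ⟨L, -, -, rfl⟩
      have : Subsingleton (Fin (0 + 0) → K) := inferInstanceAs (Subsingleton (Fin 0 → K))
      exact Set.ncard_le_one_of_subsingleton _
    exact hT.trans (Nat.one_le_pow _ _ hV)
  | succ m =>
    have hd' : varDim V = m := by simpa using hd
    obtain ⟨f, hf, hI⟩ := exists_principal (vanishingIdeal K V) h1.2 hd'
    have hV : ∀ x, x ∈ V ↔ eval x f = 0 := by
      obtain ⟨I, hVI⟩ := h1.1
      intro x
      constructor
      · intro hx
        have : f ∈ vanishingIdeal K V := by rw [hI]; exact Ideal.mem_span_singleton_self f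
        simpa [aeval_eq_eval] using mem_vanishingIdeal_iff.1 this x hx
      · intro hx
        rw [hVI, mem_zeroLocus_iff]
        intro g hg
        have hg' : g ∈ vanishingIdeal K V := by
          rw [hVI]; exact le_vanishingIdeal_zeroLocus I hg
        rw [hI] at hg'
        obtain ⟨a, rfl⟩ := Ideal.mem_span_singleton'.1 hg'
        simp [aeval_eq_eval, hx]
    have hdeg : f.totalDegree ≠ 0 := by
      intro h
      rw [totalDegree_eq_zero_iff_eq_C] at h
      apply hf.not_isUnit
      rw [h]
      refine IsUnit.map C (isUnit_iff_ne_zero.2 fun h0 => hf.ne_zero ?_)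
      rw [h, h0, C_0]
    refine le_trans (csSup_le' ?_)
      (Nat.pow_le_pow_left (degree_le_geomDegree V hd' f hf hdeg hV) 2)
    rintro _ ⟨L, -, hLfin, rfl⟩
    rcases Set.eq_empty_or_nonempty
      (tangentBundle V ∩ (L : Set (Fin (m + 1 + (m + 1)) → K))) with he | ⟨q, hq⟩
    · rw [he]; simp
    obtain ⟨b, hi, hr⟩ := exists_param L q hq.2
    obtain ⟨g1, g2⟩ := pull_set L (tangentBundle V) q b hi hr
      {c | eval c (pullPoly q b (rename (Fin.castAdd (m + 1)) f)) = 0 ∧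
        eval c (pullPoly q b (tangentPoly f)) = 0}
      (fun c => by rw [mem_tangentBundle_iff V f hI hV]; simp [eval_pullPoly]) hLfin
    rw [← g2]
    refine count_affine _ _ (Nat.one_le_iff_ne_zero.2 hdeg) ?_ ?_ g1
    · exact (totalDegree_pullPoly _ _ _).trans (totalDegree_rename_le _ _)
    · exact (totalDegree_pullPoly _ _ _).trans (totalDegree_tangentPoly f hdeg)
end

section
/- Let V ⊆ A^n be a d-dimensional irreducible variety such that there exists a nonempty Zariski open subset U ⊆ Reg(V) with T_pV = T_qV for all p, q ∈ U. Then V is a linear variety (an affine linear subspace of A^n). -/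
open MvPolynomial

/-- Directional derivative of a polynomial. -/
noncomputable def dirD {K : Type} [Field K] {n : ℕ} (y : Fin n → K)
    (f : MvPolynomial (Fin n) K) : MvPolynomial (Fin n) K :=
  ∑ i, pderiv i f * C (y i)

/-- Restriction of a polynomial to a line. -/
noncomputable def lineRes {K : Type} [Field K] {n : ℕ} (p y : Fin n → K) :
    MvPolynomial (Fin n) K →ₐ[K] Polynomial K :=
  aeval (fun i => Polynomial.C (p i) + Polynomial.C (y i) * Polynomial.X)

lemma eval_lineRes {K : Type} [Field K] {n : ℕ} (p y : Fin n → K) (t : K)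
    (f : MvPolynomial (Fin n) K) :
    (lineRes p y f).eval t = eval (p + t • y) f := by
  induction f using MvPolynomial.induction_on with
  | C a => simp [lineRes]
  | add f g hf hg => simp [hf, hg]
  | mul_X f i hf =>
    rw [map_mul, Polynomial.eval_mul, hf, map_mul]
    simp [lineRes]
    left
    ring

lemma derivative_lineRes {K : Type} [Field K] {n : ℕ} (p y : Fin n → K)
    (f : MvPolynomial (Fin n) K) :
    Polynomial.derivative (lineRes p y f) = lineRes p y (dirD y f) := by
  induction f using MvPolynomial.induction_on with
  | C a => simp [lineRes, dirD]
  | add f g hf hg =>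
    have h : dirD y (f + g) = dirD y f + dirD y g := by
      simp [dirD, add_mul, Finset.sum_add_distrib]
    rw [map_add, Polynomial.derivative_add, hf, hg, h, map_add]
  | mul_X f i hf =>
    have h : dirD y (f * X i) = dirD y f * X i + f * C (y i) := by
      simp only [dirD, pderiv_mul, pderiv_X, add_mul, Finset.sum_add_distrib, Finset.sum_mul]
      congr 1
      · exact Finset.sum_congr rfl fun _ _ => by ring
      · rw [Finset.sum_eq_single i] <;> simp +contextual [Pi.single_apply, eq_comm]
    have h2 : Polynomial.derivative (lineRes p y (X i)) = lineRes p y (C (y i)) := by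
      simp [lineRes]
    rw [map_mul, Polynomial.derivative_mul, hf, h, map_add, map_mul, map_mul, h2]

lemma lineRes_eq_zero {K : Type} [Field K] [CharZero K] {n : ℕ} (p y : Fin n → K)
    (I : Ideal (MvPolynomial (Fin n) K)) (hp : ∀ f ∈ I, eval p f = 0)
    (hD : ∀ f ∈ I, dirD y f ∈ I) (f : MvPolynomial (Fin n) K) (hf : f ∈ I) :
    lineRes p y f = 0 := by
  have key : ∀ k : ℕ, ∀ f ∈ I, (lineRes p y f).coeff k = 0 := by
    intro k
    induction k with
    | zero =>
      intro f hf
      rw [Polynomial.coeff_zero_eq_eval_zero, eval_lineRes]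
      simpa using hp f hf
    | succ k ih =>
      intro f hf
      have h := ih _ (hD f hf)
      rw [← derivative_lineRes, Polynomial.coeff_derivative] at h
      rcases mul_eq_zero.1 h with h | h
      · exact h
      · exact absurd h (by exact_mod_cast Nat.succ_ne_zero k)
  ext k
  simpa using key k f hf

/-- The tangent space as a submodule. -/
def tangentSub {K : Type} [Field K] {n : ℕ} (W : Set (Fin n → K)) (p : Fin n → K) :
    Submodule K (Fin n → K) where
  carrier := tangentSpaceAt W p
  zero_mem' := by intro f _; simp
  add_mem' := by
    intro a b ha hb f hf
    have h1 := ha f hf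
    have h2 := hb f hf
    simp only [Pi.add_apply, mul_add, Finset.sum_add_distrib, h1, h2, add_zero]
  smul_mem' := by
    intro c a ha f hf
    have h1 := ha f hf
    simp only [Pi.smul_apply, smul_eq_mul, mul_left_comm _ c, ← Finset.mul_sum, h1, mul_zero]

/-- If an irreducible `d`-dimensional variety `V ⊆ A^n` has a nonempty Zariski open
subset `U ⊆ Reg(V)` on which all tangent spaces coincide, then `V` is linear. -/
theorem linear_of_constant_tangent_space {K : Type} [Field K] [IsAlgClosed K] [CharZero K]
    {n d : ℕ} (V : Set (Fin n → K)) (h1 : IsIrreducibleVariety V) (hd : varDim V = d)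
    (Z : Set (Fin n → K)) (hZ : IsAlgebraicSet Z) (hZV : ¬ V ⊆ Z)
    (hreg : ∀ p ∈ V \ Z, IsSmoothAt V p)
    (htan : ∀ p ∈ V \ Z, ∀ q ∈ V \ Z, tangentSpaceAt V p = tangentSpaceAt V q) :
    IsLinearVariety V := by
  obtain ⟨⟨I₀, hI₀⟩, hprime⟩ := h1
  obtain ⟨J, rfl⟩ := hZ
  obtain ⟨p, hpV, hpZ⟩ := Set.not_subset.1 hZV
  have hJ : ∃ g ∈ J, eval p g ≠ 0 := by
    by_contra hcon
    push Not at hcon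
    exact hpZ fun g hg => by simpa [aeval_eq_eval] using hcon g hg
  obtain ⟨g, hgJ, hgp⟩ := hJ
  set I := vanishingIdeal K V with hIdef
  have hmemI : ∀ f : MvPolynomial (Fin n) K, f ∈ I ↔ ∀ x ∈ V, eval x f = 0 := by
    intro f
    simp [hIdef, mem_vanishingIdeal_iff, aeval_eq_eval]
  have hVI : ∀ x, (∀ f ∈ I, eval x f = 0) → x ∈ V := by
    intro x hx
    rw [hI₀]
    intro f hf
    have : f ∈ I := by
      rw [hIdef, hI₀]
      exact le_vanishingIdeal_zeroLocus I₀ hf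
    simpa [aeval_eq_eval] using hx f this
  have hgI : g ∉ I := fun h => hgp ((hmemI g).1 h p hpV)
  set T := tangentSub V p with hT
  have hTd : Module.finrank K T = varDim V := by
    have h := hreg p ⟨hpV, hpZ⟩
    unfold IsSmoothAt tangentDimAt at h
    rw [← h]
    have : Submodule.span K (tangentSpaceAt V p) = T := Submodule.span_eq T
    rw [this]
  -- the ideal is stable under derivatives in the direction of the tangent space
  have hD : ∀ y ∈ T, ∀ f ∈ I, dirD y f ∈ I := by
    intro y hy f hf
    refine (hprime.mem_or_mem (x := g) (y := dirD y f) ?_).resolve_left hgI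
    refine (hmemI _).2 fun q hq => ?_
    by_cases hqZ : q ∈ zeroLocus K J
    · have : eval q g = 0 := by simpa [aeval_eq_eval] using hqZ g hgJ
      simp [this]
    · have hy' : y ∈ tangentSpaceAt V q := by
        rw [← htan p ⟨hpV, hpZ⟩ q ⟨hq, hqZ⟩]
        exact hy
      have := hy' f hf
      simp only [map_mul, dirD, map_sum, eval_C]
      rw [this, mul_zero]
  -- hence the variety is stable under translations by the tangent space
  have htrans : ∀ x ∈ V, ∀ y ∈ T, x + y ∈ V := by
    intro x hx y hy
    refine hVI _ fun f hf => ?_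
    have h := lineRes_eq_zero x y I (fun f hf => (hmemI f).1 hf x hx) (hD y hy) f hf
    have h2 := eval_lineRes x y 1 f
    rw [h] at h2
    simpa using h2.symm
  let b := Module.finBasisOfFinrankEq K T (hTd.trans hd)
  obtain ⟨r, hr⟩ := LinearMap.exists_leftInverse_of_injective T.subtype T.ker_subtype
  have hr' : ∀ y : T, r (y : Fin n → K) = y := fun y => LinearMap.congr_fun hr y
  let φ : MvPolynomial (Fin n) K →ₐ[K] MvPolynomial (Fin d) K :=
    aeval (fun i => C (p i) + ∑ j, C ((b j : Fin n → K) i) * X j)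
  let ψ : MvPolynomial (Fin d) K →ₐ[K] MvPolynomial (Fin n) K :=
    aeval (fun j => ∑ k, C (b.repr (r (Pi.single k 1)) j) * (X k - C (p k)))
  have hφ : ∀ (a : Fin d → K) f,
      eval a (φ f) = eval (p + ((∑ j, a j • b j : T) : Fin n → K)) f := by
    intro a f
    induction f using MvPolynomial.induction_on with
    | C c => simp [φ]
    | add f g hf hg => simp [hf, hg]
    | mul_X f i hf =>
      rw [map_mul, map_mul, hf, map_mul]
      simp [φ, Finset.sum_apply, mul_comm]
  have hψ : ∀ (x : Fin n → K) j, eval x (ψ (X j)) = b.repr (r (x - p)) j := by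
    intro x j
    have h : x - p = ∑ k, (x k - p k) • (Pi.single k 1 : Fin n → K) := by
      ext i
      simp [Finset.sum_apply, Pi.single_apply]
    rw [h]
    simp [ψ, mul_comm]
  have hφψ : ∀ f, φ (ψ f) = f := by
    have : φ.comp ψ = AlgHom.id K _ := by
      refine MvPolynomial.algHom_ext fun j => ?_
      refine MvPolynomial.funext fun a => ?_
      simp only [AlgHom.comp_apply, AlgHom.id_apply]
      rw [hφ, hψ, add_sub_cancel_left, hr', Module.Basis.repr_sum_self, eval_X]
    exact fun f => DFunLike.congr_fun this f
  have hφI : ∀ f ∈ I, φ f = 0 := by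
    intro f hf
    refine MvPolynomial.funext fun a => ?_
    rw [hφ, map_zero]
    exact (hmemI f).1 hf _ (htrans p hpV _ (Subtype.property _))
  have hker : ∀ f, φ f = 0 → f ∈ I := by
    intro f hf
    by_contra hfI
    let Φ : MvPolynomial (Fin n) K ⧸ I →+* MvPolynomial (Fin d) K :=
      Ideal.Quotient.lift I φ.toRingHom hφI
    have hs : Function.Surjective Φ := fun g => ⟨Ideal.Quotient.mk I (ψ g), hφψ g⟩
    have hne : Ideal.Quotient.mk I f ≠ 0 := fun h => hfI (Ideal.Quotient.eq_zero_iff_mem.1 h)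
    have h1 := ringKrullDim_succ_le_of_surjective Φ hs
      (mem_nonZeroDivisors_of_ne_zero hne) hf
    have h2 := ringKrullDim_quotient_le I
    rw [MvPolynomial.ringKrullDim_of_isNoetherianRing, ringKrullDim_eq_zero_of_field] at h1 h2
    simp only [Nat.card_fin, zero_add, Nat.card_eq_fintype_card, Fintype.card_fin] at h1 h2
    unfold varDim at hd
    rw [← hIdef] at hd
    generalize ringKrullDim (MvPolynomial (Fin n) K ⧸ I) = m at hd h1 h2
    induction m with
    | bot => simp at h1
    | coe m =>
      induction m with
      | top => exact absurd h2 (by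
          intro h
          have h : (⊤ : ℕ∞) ≤ (n : ℕ∞) := by exact_mod_cast h
          simp at h)
      | coe m =>
        simp at hd
        subst hd
        have : m + 1 ≤ m := by exact_mod_cast h1
        omega
  refine ⟨AffineSubspace.mk' p T, ?_⟩
  ext v
  rw [SetLike.mem_coe, AffineSubspace.mem_mk', vsub_eq_sub]
  constructor
  · intro hv
    have h : v - p = ((∑ j, b.repr (r (v - p)) j • b j : T) : Fin n → K) := by
      ext i
      have h1 : X i - ψ (φ (X i)) ∈ I := hker _ (by rw [map_sub, hφψ, sub_self])
      have h2 := (hmemI _).1 h1 v hv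
      have h3 : φ (X i) = C (p i) + ∑ j, C ((b j : Fin n → K) i) * X j := by simp [φ]
      have h4 : ∀ c, ψ (C c) = C c := fun c => by simp [ψ]
      rw [h3] at h2
      simp only [map_add, map_sum, map_mul, map_sub, h4, hψ, eval_C, eval_X] at h2
      simp only [Submodule.coe_sum, Submodule.coe_smul, Finset.sum_apply, Pi.smul_apply,
        smul_eq_mul, Pi.sub_apply] at h2 ⊢
      rw [sub_eq_zero] at h2
      rw [h2, add_sub_cancel_left]
      exact Finset.sum_congr rfl fun _ _ => by simp [mul_comm]
    rw [h]
    exact Subtype.property _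
  · intro hv
    have := htrans p hpV _ hv
    simpa using this
end
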